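/- Let g = (g₁, …, gₙ) : (ℂⁿ, 0) → (ℂⁿ, 0) be a germ of a finite holomorphic map and let a₁, …, aₙ be holomorphic germs at 0 in ℂⁿ whose common zero set is {0} (so that a₁∘g, …, aₙ∘g form a regular sequence in O_{ℂⁿ,0}). Suppose that Σ_{i=1}^n a_i(g(x)) ∂g_i/∂x_ℓ ≡ 0 for every 2 ≤ ℓ ≤ n. Then for every 2 ≤ ℓ ≤ n and every 1 ≤ i ≤ n, the partial derivative ∂g_i/∂x_ℓ lies in the ideal of O_{ℂⁿ,0} generated by a₁∘g, …, aₙ∘g; i.e., there exist germs e_ℓ^{i,m} ∈ O_{ℂⁿ,0} with ∂g_i/∂x_ℓ = Σ_{m=1}^n e_ℓ^{i,m}(x) a_m(g(x)). -/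

import Mathlib

open Set Filter Topology

noncomputable section

/-- `ℂⁿ`, modeled as the space of functions `Fin n → ℂ`. -/
abbrev Cn (n : ℕ) : Type := Fin n → ℂ

theorem Complex.norm_add_sq_eq_re (a b : ℂ) :
    ‖a + b‖ ^ 2 = ‖a‖ ^ 2 + (2 * (starRingEnd ℂ) a * b).re + ‖b‖ ^ 2 := by
  simp only [← Complex.normSq_eq_norm_sq, Complex.normSq_apply, Complex.add_re, Complex.add_im,
    Complex.mul_re, Complex.mul_im, Complex.conj_re, Complex.conj_im, Complex.re_ofNat,
    Complex.im_ofNat]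
  ring

/-- A holomorphic function vanishing at `0` cannot have negative real part on a punctured
neighborhood of `0`. -/
theorem AnalyticAt.not_eventually_re_le_neg {H : ℂ → ℂ} (hH : AnalyticAt ℂ H 0) (h0 : H 0 = 0)
    {κ : ℝ} (hκ : 0 < κ) : ¬ ∀ᶠ z in 𝓝 (0 : ℂ), (H z).re ≤ -κ * ‖z‖ ^ 2 := by
  intro h
  have hdiff : ∀ᶠ z in 𝓝 (0 : ℂ), DifferentiableAt ℂ (fun z ↦ Complex.exp (H z)) z := by
    filter_upwards [hH.eventually_analyticAt] with z hz
    exact hz.differentiableAt.cexp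
  have hmax : IsLocalMax (norm ∘ fun z ↦ Complex.exp (H z)) 0 := by
    filter_upwards [h] with z hz
    simp only [Function.comp, Complex.norm_exp, h0, Complex.zero_re, Real.exp_le_exp]
    nlinarith [sq_nonneg ‖z‖]
  have hconst := Complex.eventually_eq_of_isLocalMax_norm hdiff hmax
  obtain ⟨z, hz0, hz1, hz2⟩ : ∃ z : ℂ, z ≠ 0 ∧ Complex.exp (H z) = Complex.exp (H 0) ∧
      (H z).re ≤ -κ * ‖z‖ ^ 2 := by
    have := ((hconst.and h).filter_mono (nhdsWithin_le_nhds (s := {0}ᶜ))).and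
      self_mem_nhdsWithin
    obtain ⟨z, hz, hz'⟩ := this.exists
    exact ⟨z, hz', hz⟩
  have hre : (H z).re = 0 := by
    have := congrArg norm hz1
    simpa [Complex.norm_exp, h0] using this
  have : 0 < κ * ‖z‖ ^ 2 := by positivity
  linarith

/-- A function of the form `‖φ‖² + ε ‖x‖² - A ∑ ‖qⱼ‖²`, with `φ` and fewer than `n` functions `qⱼ`
holomorphic, has no local maximum: its Levi form is positive in some direction. -/
theorem not_isLocalMax_norm_sq_sub_sum {n : ℕ} (i : Fin n) {φ : (Fin n → ℂ) → ℂ}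
    {q : Fin n → (Fin n → ℂ) → ℂ} {x : Fin n → ℂ} (hφ : AnalyticAt ℂ φ x)
    (hq : ∀ j, AnalyticAt ℂ (q j) x) {ε : ℝ} (hε : 0 < ε) (A : ℝ) :
    ¬ IsLocalMax (fun y ↦ ‖φ y‖ ^ 2 + ε * ∑ k, ‖y k‖ ^ 2
      - A * ∑ j ∈ Finset.univ.erase i, ‖q j y‖ ^ 2) x := by
  intro hmax
  obtain ⟨v, hv0, hv⟩ : ∃ v : Fin n → ℂ, v ≠ 0 ∧ ∀ j ≠ i, fderiv ℂ (q j) x v = 0 := by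
    let T : (Fin n → ℂ) →ₗ[ℂ] ({j : Fin n // j ≠ i} → ℂ) :=
      LinearMap.pi fun j ↦ (fderiv ℂ (q j) x : (Fin n → ℂ) →ₗ[ℂ] ℂ)
    have hT : LinearMap.ker T ≠ ⊥ := by
      apply LinearMap.ker_ne_bot_of_finrank_lt
      simp only [Module.finrank_fintype_fun_eq_card, Fintype.card_fin]
      simpa using Fintype.card_subtype_lt (p := fun j : Fin n ↦ j ≠ i) (x := i) (by simp)
    obtain ⟨v, hv, hv0⟩ := (Submodule.ne_bot_iff _).1 hT
    exact ⟨v, hv0, fun j hj ↦ congrFun (LinearMap.mem_ker.1 hv) ⟨j, hj⟩⟩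
  let l : ℂ → Fin n → ℂ := fun z ↦ x + z • v
  have hl0 : l 0 = x := by simp [l]
  have hl : AnalyticAt ℂ l 0 := by fun_prop
  have hl' : HasDerivAt l v 0 := by
    have h := ((hasDerivAt_id (0 : ℂ)).smul_const v).const_add x
    rwa [one_smul] at h
  have hφl : AnalyticAt ℂ (fun z ↦ φ (l z)) 0 := AnalyticAt.fun_comp (by rwa [hl0]) hl
  have hql : ∀ j, AnalyticAt ℂ (fun z ↦ q j (l z)) 0 := fun j ↦
    AnalyticAt.fun_comp (by rw [hl0]; exact hq j) hl
  set S : ℝ := ∑ k, ‖v k‖ ^ 2 with hS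
  have hSpos : 0 < S := by
    obtain ⟨k, hk⟩ := Function.ne_iff.1 hv0
    exact Finset.sum_pos' (fun _ _ ↦ by positivity)
      ⟨k, Finset.mem_univ k, by have : v k ≠ 0 := hk; positivity⟩
  let H : ℂ → ℂ := fun z ↦ 2 * (starRingEnd ℂ) (φ x) * (φ (l z) - φ x)
    + (ε : ℂ) * ∑ k, 2 * (starRingEnd ℂ) (x k) * (z * v k)
    - (A : ℂ) * ∑ j ∈ Finset.univ.erase i, 2 * (starRingEnd ℂ) (q j x) * (q j (l z) - q j x)
  have hH : AnalyticAt ℂ H 0 := by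
    have : AnalyticAt ℂ (fun z ↦ ∑ j ∈ Finset.univ.erase i,
        2 * (starRingEnd ℂ) (q j x) * (q j (l z) - q j x)) 0 :=
      Finset.analyticAt_fun_sum _ fun j _ ↦
        analyticAt_const.mul ((hql j).sub analyticAt_const)
    have h2 : AnalyticAt ℂ (fun z : ℂ ↦ ∑ k, 2 * (starRingEnd ℂ) (x k) * (z * v k)) 0 :=
      Finset.analyticAt_fun_sum _ fun j _ ↦ by fun_prop
    exact ((analyticAt_const.mul (hφl.sub analyticAt_const)).add (analyticAt_const.mul h2)).sub
      (analyticAt_const.mul this)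
  have hH0 : H 0 = 0 := by simp [H, hl0]
  have hsmall : ∀ᶠ z in 𝓝 (0 : ℂ), A * ∑ j ∈ Finset.univ.erase i, ‖q j (l z) - q j x‖ ^ 2
      ≤ ε * S / 2 * ‖z‖ ^ 2 := by
    have ho : (fun z ↦ ∑ j ∈ Finset.univ.erase i, ‖q j (l z) - q j x‖ ^ 2)
        =o[𝓝 0] fun z : ℂ ↦ ‖z‖ ^ 2 := by
      refine Asymptotics.IsLittleO.fun_sum fun j hj ↦ ?_
      have hd : HasDerivAt (fun z ↦ q j (l z)) 0 0 := by
        have h1 : HasFDerivAt (q j) (fderiv ℂ (q j) x) (l 0) := by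
          rw [hl0]; exact (hq j).differentiableAt.hasFDerivAt
        have := h1.comp_hasDerivAt 0 hl'
        rwa [hv j (Finset.ne_of_mem_erase hj)] at this
      have := hd.isLittleO
      simp only [hl0, sub_zero, smul_zero] at this
      exact this.norm_norm.pow two_pos
    have := (ho.const_mul_left A).bound (c := ε * S / 2) (by positivity)
    filter_upwards [this] with z hz
    refine (le_abs_self _).trans (hz.trans (le_of_eq ?_))
    simp
  refine hH.not_eventually_re_le_neg hH0 (κ := ε * S / 2) (by positivity) ?_
  have hmaxl : ∀ᶠ z in 𝓝 (0 : ℂ), _ :=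
    (show Tendsto l (𝓝 0) (𝓝 x) by simpa [hl0] using hl.continuousAt.tendsto).eventually hmax
  filter_upwards [hmaxl, hsmall] with z hz hs
  have e1 := Complex.norm_add_sq_eq_re (φ x) (φ (l z) - φ x)
  have e2 : ∑ k, ‖l z k‖ ^ 2 = ∑ k, ‖x k‖ ^ 2
      + ∑ k, (2 * (starRingEnd ℂ) (x k) * (z * v k)).re + ‖z‖ ^ 2 * S := by
    rw [hS, Finset.mul_sum, ← Finset.sum_add_distrib, ← Finset.sum_add_distrib]
    refine Finset.sum_congr rfl fun k _ ↦ ?_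
    rw [← mul_pow, ← norm_mul, ← Complex.norm_add_sq_eq_re]
    simp [l]
  have e3 : ∑ j ∈ Finset.univ.erase i, ‖q j (l z)‖ ^ 2
      = ∑ j ∈ Finset.univ.erase i, ‖q j x‖ ^ 2
      + ∑ j ∈ Finset.univ.erase i, (2 * (starRingEnd ℂ) (q j x) * (q j (l z) - q j x)).re
      + ∑ j ∈ Finset.univ.erase i, ‖q j (l z) - q j x‖ ^ 2 := by
    rw [← Finset.sum_add_distrib, ← Finset.sum_add_distrib]
    refine Finset.sum_congr rfl fun k _ ↦ ?_
    rw [← Complex.norm_add_sq_eq_re, add_sub_cancel]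
  have e4 : (H z).re = (2 * (starRingEnd ℂ) (φ x) * (φ (l z) - φ x)).re
      + ε * ∑ k, (2 * (starRingEnd ℂ) (x k) * (z * v k)).re
      - A * ∑ j ∈ Finset.univ.erase i,
        (2 * (starRingEnd ℂ) (q j x) * (q j (l z) - q j x)).re := by
    simp only [H, Complex.sub_re, Complex.add_re, Complex.re_ofReal_mul, Complex.re_sum]
  rw [add_sub_cancel] at e1
  simp only [e1, e2, e3] at hz
  rw [e4]
  nlinarith [sq_nonneg ‖φ (l z) - φ x‖]

/-- If holomorphic germs `f₁, …, fₙ` at `0 ∈ ℂⁿ` have `0` as an isolated common zero, then the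
coefficients of any relation `∑ cᵢ fᵢ = 0` are bounded by a multiple of `‖f‖`. -/
theorem isBigO_of_sum_mul_eq_zero {n : ℕ} {f c : Fin n → (Fin n → ℂ) → ℂ}
    (hf : ∀ j, AnalyticAt ℂ (f j) 0) (hc : ∀ j, AnalyticAt ℂ (c j) 0) (hf0 : ∀ j, f j 0 = 0)
    (hiso : ∀ᶠ x in 𝓝 0, (∀ j, f j x = 0) → x = 0)
    (hrel : ∀ᶠ x in 𝓝 0, ∑ j, f j x * c j x = 0) (i : Fin n) :
    c i =O[𝓝 0] fun x j ↦ f j x := by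
  obtain ⟨r, hr, hball⟩ : ∃ r > 0, ∀ x ∈ Metric.closedBall (0 : Fin n → ℂ) r,
      (∀ j, AnalyticAt ℂ (f j) x) ∧ (∀ j, AnalyticAt ℂ (c j) x) ∧
      ((∀ j, f j x = 0) → x = 0) ∧ ∑ j, f j x * c j x = 0 := by
    have := (eventually_all.2 fun j ↦ (hf j).eventually_analyticAt).and
      ((eventually_all.2 fun j ↦ (hc j).eventually_analyticAt).and (hiso.and hrel))
    obtain ⟨r, hr, h⟩ := Metric.nhds_basis_closedBall.eventually_iff.1 this
    exact ⟨r, hr, fun x hx ↦ h hx⟩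
  have hfcont : ∀ j, ContinuousOn (f j) (Metric.closedBall 0 r) := fun j x hx ↦
    ((hball x hx).1 j).continuousAt.continuousWithinAt
  have hccont : ∀ j, ContinuousOn (c j) (Metric.closedBall 0 r) := fun j x hx ↦
    ((hball x hx).2.1 j).continuousAt.continuousWithinAt
  have hcpt : IsCompact (Metric.closedBall (0 : Fin n → ℂ) r) := isCompact_closedBall 0 r
  obtain ⟨M, hM0, hM⟩ : ∃ M > 0, ∀ x ∈ Metric.closedBall (0 : Fin n → ℂ) r, ∀ j,
      ‖c j x‖ ≤ M := by
    obtain ⟨M, hM⟩ := hcpt.exists_bound_of_continuousOn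
      (f := fun x j ↦ c j x) (continuousOn_pi.2 hccont)
    exact ⟨max M 1, by positivity, fun x hx j ↦
      (norm_le_pi_norm (fun j ↦ c j x) j).trans ((hM x hx).trans (le_max_left _ _))⟩
  obtain ⟨m, hm0, hm⟩ : ∃ m > 0, ∀ x ∈ Metric.sphere (0 : Fin n → ℂ) r,
      m ≤ ∑ j, ‖f j x‖ ^ 2 := by
    have hcont : ContinuousOn (fun x ↦ ∑ j, ‖f j x‖ ^ 2) (Metric.sphere (0 : Fin n → ℂ) r) :=
      continuousOn_finsetSum _ fun j _ ↦
        (((hfcont j).mono Metric.sphere_subset_closedBall).norm.pow 2)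
    refine (isCompact_sphere 0 r).exists_forall_le' hcont fun x hx ↦ ?_
    have hxc := Metric.sphere_subset_closedBall hx
    have hx0 : x ≠ 0 := Metric.ne_of_mem_sphere hx hr.ne'
    obtain ⟨j, hj⟩ := not_forall.1 (mt (hball x hxc).2.2.1 hx0)
    exact Finset.sum_pos' (fun _ _ ↦ by positivity) ⟨j, Finset.mem_univ j, by positivity⟩
  have hn : (0 : ℝ) < n := by exact_mod_cast i.pos
  set A : ℝ := 16 * n * M ^ 2 / m with hA
  have hApos : 0 < A := by positivity
  have hAm : A * m = 16 * n * M ^ 2 := by rw [hA]; field_simp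
  have hn1 : (1 : ℝ) ≤ n := by exact_mod_cast i.pos
  have key : ∀ᶠ x in 𝓝 (0 : Fin n → ℂ), ‖c i x‖ ^ 2 ≤ A * ∑ j, ‖f j x‖ ^ 2 := by
    have hsmall : ∀ᶠ x in 𝓝 (0 : Fin n → ℂ), ∑ j, ‖f j x‖ ^ 2 < m / 4 := by
      have : ContinuousAt (fun x ↦ ∑ j, ‖f j x‖ ^ 2) 0 :=
        tendsto_finsetSum _ fun j _ ↦ ((hf j).continuousAt.norm.pow 2)
      refine this.eventually_lt continuousAt_const ?_
      simp [hf0, hm0]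
    filter_upwards [hsmall, Metric.closedBall_mem_nhds 0 hr] with y hy hyr
    set Y := ∑ j, ‖f j y‖ ^ 2 with hY
    let q : Fin n → (Fin n → ℂ) → ℂ := fun j x ↦ f j x - f j y
    have hqcont : ∀ j, ContinuousOn (q j) (Metric.closedBall 0 r) := fun j ↦
      (hfcont j).sub continuousOn_const
    refine le_of_forall_pos_le_add fun δ hδ ↦ ?_
    obtain ⟨ε, hε, hεδ⟩ : ∃ ε > 0, ε * (n * r ^ 2) = δ :=
      ⟨δ / (n * r ^ 2), by positivity, by field_simp⟩
    let u : (Fin n → ℂ) → ℝ := fun x ↦ ‖c i x‖ ^ 2 + ε * ∑ k, ‖x k‖ ^ 2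
      - A * ∑ j ∈ Finset.univ.erase i, ‖q j x‖ ^ 2
    have hucont : ContinuousOn u (Metric.closedBall 0 r) := by
      refine (((hccont i).norm.pow 2).add (Continuous.continuousOn (by fun_prop))).sub
        (continuousOn_const.mul (continuousOn_finsetSum _ fun j _ ↦ (hqcont j).norm.pow 2))
    let K : Set (Fin n → ℂ) := Metric.closedBall 0 r ∩ {x | ‖q i x‖ ^ 2 ≤ m / 8}
    have hKcpt : IsCompact K := by
      refine hcpt.of_isClosed_subset ?_ inter_subset_left
      exact ((hqcont i).norm.pow 2).preimage_isClosed_of_isClosed Metric.isClosed_closedBall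
        isClosed_Iic
    have hyK : y ∈ K := ⟨hyr, show ‖q i y‖ ^ 2 ≤ m / 8 by
      simpa [q] using (div_pos hm0 (by norm_num : (0 : ℝ) < 8)).le⟩
    obtain ⟨x, hxK, hxmax⟩ := hKcpt.exists_isMaxOn ⟨y, hyK⟩ (hucont.mono inter_subset_left)
    obtain ⟨hfx, hcx, -, hrelx⟩ := hball x hxK.1
    have hqx : ∀ j, AnalyticAt ℂ (q j) x := fun j ↦ (hfx j).sub analyticAt_const
    have huy : ‖c i y‖ ^ 2 ≤ u y := by
      have : 0 ≤ ε * ∑ k, ‖y k‖ ^ 2 := by positivity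
      simpa [u, q] using this
    refine huy.trans ((hxmax hyK).trans ?_)
    have hxr : ε * ∑ k, ‖x k‖ ^ 2 ≤ δ := by
      rw [← hεδ]
      gcongr
      refine (Finset.sum_le_card_nsmul _ _ (r ^ 2) fun k _ ↦ ?_).trans (by simp)
      have := (norm_le_pi_norm x k).trans (mem_closedBall_zero_iff.1 hxK.1)
      gcongr
    set Q := ∑ j ∈ Finset.univ.erase i, ‖q j x‖ ^ 2 with hQ
    have hY0 : 0 ≤ Y := by positivity
    suffices h : ‖c i x‖ ^ 2 ≤ A * Y + A * Q by
      simp only [u]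
      linarith
    have hsum : ∑ j, ‖q j x‖ ^ 2 = ‖q i x‖ ^ 2 + Q :=
      (Finset.add_sum_erase _ _ (Finset.mem_univ i)).symm
    rcases (mem_closedBall_zero_iff.1 hxK.1).eq_or_lt with hxs | hxs
    · have h1 : ∑ j, ‖f j x‖ ^ 2 ≤ 2 * ∑ j, ‖q j x‖ ^ 2 + 2 * Y := by
        rw [hY, Finset.mul_sum, Finset.mul_sum, ← Finset.sum_add_distrib]
        refine Finset.sum_le_sum fun j _ ↦ ?_
        have : ‖f j x‖ ≤ ‖q j x‖ + ‖f j y‖ := by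
          simpa [q] using norm_add_le (q j x) (f j y)
        nlinarith [sq_nonneg (‖q j x‖ - ‖f j y‖), norm_nonneg (f j x)]
      have h2 := hm x (mem_sphere_zero_iff_norm.2 hxs)
      have h3 : ‖q i x‖ ^ 2 ≤ m / 8 := hxK.2
      have h4 : m / 8 ≤ Q := by linarith
      have h5 : ‖c i x‖ ^ 2 ≤ M ^ 2 := by gcongr; exact hM x hxK.1 i
      nlinarith [mul_le_mul_of_nonneg_left h4 hApos.le, mul_nonneg hApos.le hY0, sq_nonneg M]
    rcases (show ‖q i x‖ ^ 2 ≤ m / 8 from hxK.2).eq_or_lt with hxq | hxq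
    · have hrel' : c i x * q i x
          = -(∑ j, c j x * f j y + ∑ j ∈ Finset.univ.erase i, c j x * q j x) := by
        have h1 : c i x * q i x + ∑ j ∈ Finset.univ.erase i, c j x * q j x
            = ∑ j, c j x * q j x :=
          Finset.add_sum_erase Finset.univ (fun j ↦ c j x * q j x) (Finset.mem_univ i)
        have h2 : ∑ j, c j x * q j x = ∑ j, f j x * c j x - ∑ j, c j x * f j y := by
          rw [← Finset.sum_sub_distrib]
          exact Finset.sum_congr rfl fun j _ ↦ by simp only [q]; ring
        rw [hrelx] at h2
        linear_combination h1 + h2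
      have hCS : ∀ (s : Finset (Fin n)) (b : Fin n → ℂ),
          ‖∑ j ∈ s, c j x * b j‖ ^ 2 ≤ n * M ^ 2 * ∑ j ∈ s, ‖b j‖ ^ 2 := by
        intro s b
        calc ‖∑ j ∈ s, c j x * b j‖ ^ 2 ≤ (∑ j ∈ s, M * ‖b j‖) ^ 2 := by
              gcongr
              refine norm_sum_le_of_le _ fun j _ ↦ ?_
              rw [norm_mul]
              gcongr
              exact hM x hxK.1 j
          _ ≤ s.card * ∑ j ∈ s, (M * ‖b j‖) ^ 2 := sq_sum_le_card_mul_sum_sq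
          _ ≤ n * ∑ j ∈ s, (M * ‖b j‖) ^ 2 := by
              gcongr
              simpa using s.card_le_univ
          _ = n * M ^ 2 * ∑ j ∈ s, ‖b j‖ ^ 2 := by
              simp only [mul_pow, ← Finset.mul_sum]
              ring
      have h1 := hCS Finset.univ fun j ↦ f j y
      have h2 := hCS (Finset.univ.erase i) fun j ↦ q j x
      have h3 := congrArg (fun z ↦ ‖z‖ ^ 2) hrel'
      simp only [norm_mul, norm_neg, mul_pow, hxq] at h3
      have h4 := norm_add_le (∑ j, c j x * f j y) (∑ j ∈ Finset.univ.erase i, c j x * q j x)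
      have h5 : ‖c i x‖ ^ 2 * (m / 8) ≤ 2 * (n * M ^ 2 * Y) + 2 * (n * M ^ 2 * Q) := by
        rw [h3]
        nlinarith [sq_nonneg (‖∑ j, c j x * f j y‖ -
          ‖∑ j ∈ Finset.univ.erase i, c j x * q j x‖), norm_nonneg (∑ j, c j x * f j y +
          ∑ j ∈ Finset.univ.erase i, c j x * q j x)]
      have h6 : (A * Y + A * Q) * (m / 8) = 2 * (n * M ^ 2 * Y) + 2 * (n * M ^ 2 * Q) := by
        linear_combination (Y + Q) / 8 * hAm
      exact le_of_mul_le_mul_right (h5.trans h6.ge) (by positivity)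
    · refine absurd ?_ (not_isLocalMax_norm_sq_sub_sum i (hcx i) hqx hε A)
      refine hxmax.isLocalMax ?_
      refine inter_mem (Metric.closedBall_mem_nhds_of_mem (by simpa using hxs)) ?_
      filter_upwards [((hqx i).continuousAt.norm.pow 2).eventually_lt continuousAt_const hxq]
        with z hz using hz.le
  refine Asymptotics.IsBigO.of_norm_right (Asymptotics.IsBigO.of_pow two_ne_zero ?_)
  refine Asymptotics.IsBigO.of_bound (A * n) ?_
  filter_upwards [key] with x hx
  simp only [Pi.pow_apply, norm_pow, norm_norm]
  refine hx.trans ?_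
  rw [mul_assoc]
  gcongr
  refine (Finset.sum_le_card_nsmul _ _ (‖fun j ↦ f j x‖ ^ 2) fun k _ ↦ ?_).trans (by simp)
  have := norm_le_pi_norm (fun j ↦ f j x) k
  gcongr

/-- A holomorphic map germ with `0` as an isolated zero cannot satisfy `∂ᵥ g = O(g)` for a
nonzero direction `v`. -/
theorem not_isBigO_fderiv_apply_of_isolated_zero {n : ℕ} {g : (Fin n → ℂ) → Fin n → ℂ}
    (hg : AnalyticAt ℂ g 0) (hg0 : g 0 = 0) (hiso : ∀ᶠ x in 𝓝 0, g x = 0 → x = 0)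
    {v : Fin n → ℂ} (hv : v ≠ 0) : ¬ (fun x ↦ fderiv ℂ g x v) =O[𝓝 0] g := by
  intro h
  obtain ⟨C, hC⟩ := h.bound
  let l : ℝ → Fin n → ℂ := fun t ↦ (t : ℂ) • v
  have hl : Continuous l := by fun_prop
  have hl0 : Tendsto l (𝓝 0) (𝓝 0) := by simpa [l] using hl.tendsto 0
  obtain ⟨s, hs, hball⟩ := Metric.nhds_basis_closedBall.eventually_iff.1
    (hl0.eventually (hg.eventually_analyticAt.and (hiso.and hC)))
  have hmem : ∀ t ∈ Icc 0 s, t ∈ Metric.closedBall (0 : ℝ) s := fun t ht ↦ by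
    simpa [abs_of_nonneg ht.1] using ht.2
  have hderiv : ∀ t ∈ Icc 0 s, HasDerivAt (fun t ↦ g (l t)) (fderiv ℂ g (l t) v) t := by
    intro t ht
    have h1 : HasDerivAt l v t := by
      exact ((Complex.ofRealCLM.hasDerivAt (x := t)).smul_const v).congr_deriv (by simp)
    exact ((hball (hmem t ht)).1.differentiableAt.hasFDerivAt.restrictScalars ℝ).comp_hasDerivAt
      t h1
  have hzero := eq_zero_of_abs_deriv_le_mul_abs_self_of_eq_zero_right (K := C)
    (fun t ht ↦ (hderiv t ht).continuousAt.continuousWithinAt)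
    (fun t ht ↦ (hderiv t (Ico_subset_Icc_self ht)).hasDerivWithinAt) (by simpa [l] using hg0)
    (fun t ht ↦ (hball (hmem t (Ico_subset_Icc_self ht))).2.2) s (right_mem_Icc.2 hs.le)
  have := (hball (hmem s (right_mem_Icc.2 hs.le))).2.1 hzero
  simp [l, hs.ne', hv] at this

/-- Let `g = (g₁, …, gₙ) : (ℂⁿ, 0) → (ℂⁿ, 0)` be (a representative of) a germ of a
finite holomorphic map and let `a₁, …, aₙ` be holomorphic germs at `0` whose common zero
set is `{0}` (so the `aᵢ∘g` form a regular sequence in `O_{ℂⁿ,0}`).  Suppose that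
`Σᵢ aᵢ(g x) ∂gᵢ/∂x_ℓ ≡ 0` near `0` for every `ℓ ≠ 1`.  Then for every `ℓ ≠ 1` and every
`i`, the partial derivative `∂gᵢ/∂x_ℓ` lies in the ideal of `O_{ℂⁿ,0}` generated by
`a₁∘g, …, aₙ∘g`. -/
theorem partials_in_ideal_of_pulled_back_regular_sequence
    {n : ℕ} (hn : 0 < n) (g : Cn n → Cn n) (U : Set (Cn n))
    (hUopen : IsOpen U) (hU0 : (0 : Cn n) ∈ U)
    (hghol : AnalyticOnNhd ℂ g U) (hg0 : g 0 = 0)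
    (hfin : U ∩ g ⁻¹' {0} = {0})
    (a : Fin n → Cn n → ℂ) (V : Set (Cn n))
    (hVopen : IsOpen V) (hV0 : (0 : Cn n) ∈ V)
    (ha : ∀ i, AnalyticOnNhd ℂ (a i) V)
    (hzero : {x ∈ V | ∀ i, a i x = 0} = {0})
    (hvanish : ∀ ℓ : Fin n, ℓ ≠ ⟨0, hn⟩ → ∀ᶠ x in nhds (0 : Cn n),
      ∑ i, a i (g x) * fderiv ℂ g x (Pi.single ℓ 1) i = 0) :
    ∀ ℓ : Fin n, ℓ ≠ ⟨0, hn⟩ → ∀ i : Fin n,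
      ∃ e : Fin n → Cn n → ℂ, (∀ m, AnalyticAt ℂ (e m) 0) ∧
        ∀ᶠ x in nhds (0 : Cn n),
          fderiv ℂ g x (Pi.single ℓ 1) i = ∑ m, e m x * a m (g x) := by
  intro ℓ hℓ
  exfalso
  have hga : AnalyticAt ℂ g 0 := hghol 0 hU0
  have hg_tendsto : Tendsto g (𝓝 0) (𝓝 0) := by simpa [hg0] using hga.continuousAt.tendsto
  have hiso : ∀ᶠ x in 𝓝 0, g x = 0 → x = 0 := by
    filter_upwards [hUopen.mem_nhds hU0] with x hx hgx
    exact hfin.subset ⟨hx, hgx⟩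
  have ha0 : ∀ j, a j 0 = 0 := (hzero.superset (mem_singleton 0)).2
  have hag : ∀ j, AnalyticAt ℂ (fun x ↦ a j (g x)) 0 := fun j ↦
    AnalyticAt.fun_comp (by rw [hg0]; exact ha j 0 hV0) hga
  have hfd : AnalyticAt ℂ (fun x ↦ fderiv ℂ g x (Pi.single ℓ 1)) 0 :=
    ((ContinuousLinearMap.apply ℂ (Cn n) (Pi.single ℓ 1 : Cn n)).analyticAt _).comp hga.fderiv
  have hisoa : ∀ᶠ x in 𝓝 0, (∀ j, a j (g x) = 0) → x = 0 := by
    filter_upwards [hiso, hg_tendsto.eventually (hVopen.mem_nhds hV0)] with x hx hxV hax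
    exact hx (hzero.subset ⟨hxV, hax⟩)
  have hc : (fun x ↦ fderiv ℂ g x (Pi.single ℓ 1)) =O[𝓝 0] fun x j ↦ a j (g x) :=
    Asymptotics.isBigO_pi.2 <| isBigO_of_sum_mul_eq_zero hag (analyticAt_pi_iff.1 hfd)
      (fun j ↦ by rw [hg0, ha0]) hisoa (hvanish ℓ hℓ)
  have hag_le : (fun x j ↦ a j (g x)) =O[𝓝 0] g := by
    refine Asymptotics.isBigO_pi.2 fun j ↦ ?_
    have := (ha j 0 hV0).differentiableAt.isBigO_sub.comp_tendsto hg_tendsto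
    simpa [Function.comp_def, ha0] using this
  exact not_isBigO_fderiv_apply_of_isolated_zero hga hg0 hiso (by simp) (hc.trans hag_le)
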